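/- Let n ≥ 3 and let x_1 < x_2 < … < x_n be real numbers. Define the B-spline B(t) = ∑_{k=1}^n (x_k − t)_+^{n−2} / ∏_{j≠k}(x_k − x_j). Then (n−1)·B is the probability density function of the random variable ⟨x, S⟩ = ∑_{k=1}^n x_k S_k, where S is uniformly distributed on the standard simplex Δ_{n−1}; that is, for every bounded continuous function g: ℝ → ℝ, (n−1) ∫_ℝ B(t) g(t) dt = E[ g(⟨x, S⟩) ]. -/

import Mathlib

open Real Finset MeasureTheory

/-- The divided difference of `f` at the nodes `x`, as a sum over the nodes. -/
noncomputable def dividedDiff {n : ℕ} (x : Fin n → ℝ) (f : ℝ → ℝ) : ℝ :=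
  ∑ k, f (x k) / ∏ j ∈ univ.erase k, (x k - x j)

lemma prod_univ_erase_zero {m : ℕ} (h : Fin (m + 1) → ℝ) :
    ∏ j ∈ univ.erase 0, h j = ∏ j : Fin m, h j.succ := by
  have : (univ.erase 0 : Finset (Fin (m + 1))) = univ.map (Fin.succEmb m) := by
    ext j
    cases j using Fin.cases <;> simp [Fin.succ_ne_zero]
  rw [this, prod_map]
  rfl

lemma prod_univ_erase_succ {m : ℕ} (h : Fin (m + 1) → ℝ) (i : Fin m) :
    ∏ j ∈ univ.erase i.succ, h j = h 0 * ∏ j ∈ univ.erase i, h j.succ := by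
  have : (univ.erase i.succ : Finset (Fin (m + 1))) =
      cons 0 ((univ.erase i).map (Fin.succEmb m)) (by simp [Fin.succ_ne_zero]) := by
    ext j
    cases j using Fin.cases <;> simp [Fin.succ_ne_zero, (Fin.succ_ne_zero _).symm]
  rw [this, prod_cons, prod_map]
  rfl

lemma dividedDiff_cons {m : ℕ} (a : ℝ) (y : Fin m → ℝ) (f : ℝ → ℝ) :
    dividedDiff (Fin.cons a y : Fin (m + 1) → ℝ) f = f a / ∏ j, (a - y j) +
      ∑ i, f (y i) / ((y i - a) * ∏ j ∈ univ.erase i, (y i - y j)) := by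
  simp only [dividedDiff, Fin.sum_univ_succ, prod_univ_erase_zero, prod_univ_erase_succ,
    Fin.cons_zero, Fin.cons_succ]

lemma dividedDiff_cons_cons {m : ℕ} {a b : ℝ} {y : Fin m → ℝ} (hab : a ≠ b)
    (ha : ∀ i, y i ≠ a) (hb : ∀ i, y i ≠ b) (f : ℝ → ℝ) :
    dividedDiff (Fin.cons a (Fin.cons b y : Fin (m + 1) → ℝ) : Fin (m + 2) → ℝ) f =
      (dividedDiff (Fin.cons b y : Fin (m + 1) → ℝ) f -
        dividedDiff (Fin.cons a y : Fin (m + 1) → ℝ) f) / (b - a) := by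
  have h₁ : a - b ≠ 0 := sub_ne_zero.2 hab
  have h₂ : b - a ≠ 0 := sub_ne_zero.2 hab.symm
  have key : ∑ i, f (y i) / ((y i - a) * ((y i - b) * ∏ j ∈ univ.erase i, (y i - y j))) =
      (∑ i, f (y i) / ((y i - b) * ∏ j ∈ univ.erase i, (y i - y j)) -
        ∑ i, f (y i) / ((y i - a) * ∏ j ∈ univ.erase i, (y i - y j))) / (b - a) := by
    rw [← sum_sub_distrib, sum_div]
    refine sum_congr rfl fun i _ ↦ ?_
    have h₃ := sub_ne_zero.2 (ha i)
    have h₄ := sub_ne_zero.2 (hb i)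
    generalize ∏ j ∈ univ.erase i, (y i - y j) = P
    rcases eq_or_ne P 0 with rfl | hP
    · simp
    · field_simp
      ring
  rw [dividedDiff_cons, Fin.sum_univ_succ]
  simp only [Fin.prod_univ_succ, Fin.cons_zero, Fin.cons_succ, prod_univ_erase_zero,
    prod_univ_erase_succ]
  rw [key, dividedDiff_cons, dividedDiff_cons]
  generalize ∏ j, (a - y j) = P
  generalize ∏ j, (b - y j) = Q
  have e₁ : f a / ((a - b) * P) = - (f a / P) / (b - a) := by
    rw [← neg_sub b a, neg_mul, div_neg, neg_div, mul_comm, div_div]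
  have e₂ : f b / ((b - a) * Q) = f b / Q / (b - a) := by
    rw [mul_comm, div_div]
  rw [e₁, e₂]
  ring

lemma dividedDiff_pow_of_lt {n d : ℕ} {x : Fin n → ℝ} (hx : x.Injective) (hd : d + 1 < n) (t : ℝ) :
    dividedDiff x (fun s ↦ (s - t) ^ d) = 0 := by
  have hdeg : ((Polynomial.X - Polynomial.C t) ^ d).degree = (d : WithBot ℕ) := by
    simp [Polynomial.degree_pow, Polynomial.degree_X_sub_C]
  have h := Lagrange.coeff_eq_sum (s := univ) (v := x) hx.injOn
    (P := (Polynomial.X - Polynomial.C t) ^ d) (by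
      rw [hdeg, card_univ, Fintype.card_fin]; exact_mod_cast (by lia))
  rw [Polynomial.coeff_eq_zero_of_degree_lt (by
    rw [hdeg, card_univ, Fintype.card_fin]; exact_mod_cast (by lia))] at h
  simpa [dividedDiff] using h.symm

lemma dividedDiff_pow_self {d : ℕ} {x : Fin (d + 1) → ℝ} (hx : x.Injective) (t : ℝ) :
    dividedDiff x (fun s ↦ (s - t) ^ d) = 1 := by
  have hdeg : ((Polynomial.X - Polynomial.C t) ^ d).degree = (d : WithBot ℕ) := by
    simp [Polynomial.degree_pow, Polynomial.degree_X_sub_C]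
  have h := Lagrange.leadingCoeff_eq_sum (s := univ) (v := x) hx.injOn
    (P := (Polynomial.X - Polynomial.C t) ^ d) (by
      rw [hdeg, card_univ, Fintype.card_fin]; norm_cast)
  rw [Polynomial.Monic.leadingCoeff ((Polynomial.monic_X_sub_C t).pow d)] at h
  simpa [dividedDiff] using h.symm

/-- The antiderivative of `g` vanishing at `c`. -/
noncomputable def primitiveFrom (c : ℝ) (g : ℝ → ℝ) (x : ℝ) : ℝ := ∫ t in c..x, g t

lemma hasDerivAt_primitiveFrom (c : ℝ) {g : ℝ → ℝ} (hg : Continuous g) (x : ℝ) :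
    HasDerivAt (primitiveFrom c g) (g x) x :=
  intervalIntegral.integral_hasDerivAt_right (hg.intervalIntegrable _ _)
    (hg.stronglyMeasurableAtFilter _ _) hg.continuousAt

lemma continuous_primitiveFrom (c : ℝ) {g : ℝ → ℝ} (hg : Continuous g) :
    Continuous (primitiveFrom c g) :=
  continuous_iff_continuousAt.2 fun x ↦ (hasDerivAt_primitiveFrom c hg x).continuousAt

/-- Cauchy's formula for repeated integration. -/
lemma iterate_primitiveFrom (c : ℝ) (m : ℕ) {g : ℝ → ℝ} (hg : Continuous g) (x : ℝ) :
    (m.factorial : ℝ) * (primitiveFrom c)^[m + 1] g x = ∫ t in c..x, (x - t) ^ m * g t := by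
  induction m generalizing g with
  | zero => simp [primitiveFrom]
  | succ m ih =>
    have hu : ∀ t ∈ Set.uIcc c x,
        HasDerivAt (fun t ↦ (x - t) ^ (m + 1)) (-((m + 1 : ℝ) * (x - t) ^ m)) t := fun t _ ↦ by
      simpa using ((hasDerivAt_id' t).const_sub x).fun_pow (m + 1)
    have hparts := intervalIntegral.integral_mul_deriv_eq_deriv_mul hu
      (fun t _ ↦ hasDerivAt_primitiveFrom c hg t)
      ((by fun_prop : Continuous fun t ↦ -((m + 1 : ℝ) * (x - t) ^ m)).intervalIntegrable _ _)
      (hg.intervalIntegrable _ _)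
    rw [hparts, Function.iterate_succ_apply, Nat.factorial_succ, Nat.cast_mul, mul_assoc,
      ih (continuous_primitiveFrom c hg)]
    have h0 : primitiveFrom c g c = 0 := by simp [primitiveFrom]
    simp only [h0, neg_mul, intervalIntegral.integral_neg, mul_assoc,
      intervalIntegral.integral_const_mul]
    simp

/-- The corner simplex in `ℝ^m`. -/
def cornerSimplex (m : ℕ) : Set (Fin m → ℝ) := {u | (∀ i, 0 ≤ u i) ∧ ∑ i, u i ≤ 1}

lemma isCompact_cornerSimplex (m : ℕ) : IsCompact (cornerSimplex m) := by
  refine (isCompact_Icc (a := (0 : Fin m → ℝ)) (b := 1)).of_isClosed_subset ?_ ?_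
  · have h : IsClosed {u : Fin m → ℝ | ∀ i, 0 ≤ u i} := by
      simp only [Set.ofPred_forall]
      exact isClosed_iInter fun i ↦ isClosed_le continuous_const (continuous_apply i)
    exact h.inter (isClosed_le (f := fun u : Fin m → ℝ ↦ ∑ i, u i) (by fun_prop) continuous_const)
  · exact fun u hu ↦ ⟨hu.1, fun i ↦
      (single_le_sum (fun j _ ↦ hu.1 j) (mem_univ i)).trans hu.2⟩

lemma cons_mem_cornerSimplex {m : ℕ} {s : ℝ} {v : Fin m → ℝ} :
    (Fin.cons s v : Fin (m + 1) → ℝ) ∈ cornerSimplex (m + 1) ↔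
      v ∈ cornerSimplex m ∧ s ∈ Set.Icc 0 (1 - ∑ i, v i) := by
  simp only [cornerSimplex, Set.mem_ofPred_eq, Fin.forall_fin_succ, Fin.cons_zero, Fin.cons_succ,
    Fin.sum_univ_succ, Set.mem_Icc]
  constructor
  · rintro ⟨⟨h₁, h₂⟩, h₃⟩
    exact ⟨⟨h₂, by linarith⟩, h₁, by linarith⟩
  · rintro ⟨⟨h₁, h₂⟩, h₃, h₄⟩
    exact ⟨⟨h₃, h₁⟩, by linarith⟩

lemma setIntegral_cornerSimplex_succ {m : ℕ} {F : (Fin (m + 1) → ℝ) → ℝ} (hF : Continuous F) :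
    ∫ u in cornerSimplex (m + 1), F u =
      ∫ v in cornerSimplex m, ∫ s in (0 : ℝ)..(1 - ∑ i, v i), F (Fin.cons s v) := by
  have hmp := (volume_preserving_piFinSuccAbove (fun _ : Fin (m + 1) ↦ ℝ) 0).symm
  have hcons : ∀ p : ℝ × (Fin m → ℝ),
      (MeasurableEquiv.piFinSuccAbove (fun _ : Fin (m + 1) ↦ ℝ) 0).symm p = Fin.cons p.1 p.2 :=
    fun p ↦ by simp [MeasurableEquiv.piFinSuccAbove]; rfl
  have hmeas := (isCompact_cornerSimplex (m + 1)).measurableSet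
  have hint : Integrable ((cornerSimplex (m + 1)).indicator F) :=
    (hF.continuousOn.integrableOn_compact (isCompact_cornerSimplex (m + 1))).integrable_indicator
      hmeas
  have hint' := (hmp.integrable_comp_emb (MeasurableEquiv.measurableEmbedding _)).2 hint
  rw [← integral_indicator hmeas,
    ← hmp.integral_comp (MeasurableEquiv.measurableEmbedding _), Measure.volume_eq_prod,
    integral_prod_symm (fun p ↦ (cornerSimplex (m + 1)).indicator F
      ((MeasurableEquiv.piFinSuccAbove (fun _ : Fin (m + 1) ↦ ℝ) 0).symm p)) hint', ← integral_indicator (isCompact_cornerSimplex m).measurableSet]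
  refine integral_congr_ae (.of_forall fun v ↦ ?_)
  simp only [hcons]
  by_cases hv : v ∈ cornerSimplex m
  · rw [Set.indicator_of_mem hv, intervalIntegral.integral_of_le (by linarith [hv.2]),
      ← integral_Icc_eq_integral_Ioc, ← integral_indicator measurableSet_Icc]
    refine integral_congr_ae (.of_forall fun s ↦ ?_)
    simp only [Set.indicator, cons_mem_cornerSimplex, hv, true_and]
  · rw [Set.indicator_of_notMem hv]
    simp [Set.indicator, cons_mem_cornerSimplex, hv]

lemma setIntegral_cornerSimplex_primitive {m : ℕ} {a b c : ℝ} (hab : a ≠ b) (y : Fin m → ℝ)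
    {g : ℝ → ℝ} (hg : Continuous g) :
    ∫ u in cornerSimplex (m + 1),
        g (a + ∑ i, u i * ((Fin.cons b y : Fin (m + 1) → ℝ) i - a)) =
      ((∫ v in cornerSimplex m, primitiveFrom c g (b + ∑ i, v i * (y i - b))) -
        ∫ v in cornerSimplex m, primitiveFrom c g (a + ∑ i, v i * (y i - a))) / (b - a) := by
  have hba : b - a ≠ 0 := sub_ne_zero.2 hab.symm
  have hG := continuous_primitiveFrom c hg
  have hint : ∀ d : ℝ, IntegrableOn (fun v : Fin m → ℝ ↦
      primitiveFrom c g (d + ∑ i, v i * (y i - d))) (cornerSimplex m) := fun d ↦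
    (by fun_prop : Continuous fun v : Fin m → ℝ ↦
      primitiveFrom c g (d + ∑ i, v i * (y i - d))).continuousOn.integrableOn_compact (isCompact_cornerSimplex m)
  rw [setIntegral_cornerSimplex_succ (F := fun u ↦
      g (a + ∑ i, u i * ((Fin.cons b y : Fin (m + 1) → ℝ) i - a))) (by fun_prop),
    ← integral_sub (hint b) (hint a), ← integral_div]
  refine integral_congr_ae (.of_forall fun v ↦ ?_)
  simp only [Fin.sum_univ_succ, Fin.cons_zero, Fin.cons_succ]
  have hderiv : ∀ s ∈ Set.uIcc 0 (1 - ∑ i, v i),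
      HasDerivAt (fun s ↦ primitiveFrom c g (a + (s * (b - a) + ∑ i, v i * (y i - a))) / (b - a))
        (g (a + (s * (b - a) + ∑ i, v i * (y i - a)))) s := fun s _ ↦ by
    have h₁ : HasDerivAt (fun s ↦ a + (s * (b - a) + ∑ i, v i * (y i - a))) (b - a) s := by
      simpa using (((hasDerivAt_id' s).mul_const (b - a)).add_const
        (∑ i, v i * (y i - a))).const_add a
    simpa [hba] using ((hasDerivAt_primitiveFrom c hg _).comp s h₁).div_const (b - a)
  rw [intervalIntegral.integral_eq_sub_of_hasDerivAt hderiv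
    (Continuous.intervalIntegrable (by fun_prop) _ _), ← sub_div]
  have e : a + ((1 - ∑ i, v i) * (b - a) + ∑ i, v i * (y i - a)) =
      b + ∑ i, v i * (y i - b) := by
    simp only [mul_sub, sum_sub_distrib, ← sum_mul]
    ring
  rw [e]
  simp

/-- The **Hermite–Genocchi formula**. -/
lemma hermite_genocchi (c : ℝ) {m : ℕ} {a : ℝ} {y : Fin m → ℝ} (hy : y.Injective)
    (ha : ∀ i, y i ≠ a) {g : ℝ → ℝ} (hg : Continuous g) :
    ∫ u in cornerSimplex m, g (a + ∑ i, u i * (y i - a)) =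
      dividedDiff (Fin.cons a y : Fin (m + 1) → ℝ) ((primitiveFrom c)^[m] g) := by
  induction m generalizing a g with
  | zero =>
    have : cornerSimplex 0 = Set.univ := by
      ext; simp [cornerSimplex]
    simp [dividedDiff_cons, this, measureReal_def, volume_pi]
  | succ m ih =>
    obtain ⟨b, z, rfl⟩ : ∃ b z, y = Fin.cons b z := ⟨y 0, Fin.tail y, (Fin.cons_self_tail y).symm⟩
    have hb : ∀ i, z i ≠ b := fun i h ↦
      Fin.succ_ne_zero i (hy (by simpa using h))
    have hz : z.Injective := fun i j h ↦
      Fin.succ_injective _ (hy (by simpa using h))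
    have hza : ∀ i, z i ≠ a := fun i ↦ by simpa using ha i.succ
    have hab : a ≠ b := by simpa using (ha 0).symm
    rw [setIntegral_cornerSimplex_primitive (c := c) hab z hg,
      ih hz hb (continuous_primitiveFrom c hg), ih hz hza (continuous_primitiveFrom c hg),
      dividedDiff_cons_cons hab hza hb, Function.iterate_succ_apply]

/-- The parametrization of the hyperplane `∑ k, s k = 1` by all coordinates but the first. -/
noncomputable def simplexParam (m : ℕ) (u : Fin m → ℝ) : EuclideanSpace ℝ (Fin (m + 1)) :=
  WithLp.toLp 2 (Fin.cons (1 - ∑ i, u i) u)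

/-- The hyperplane of vectors with zero coordinate sum. -/
noncomputable def zeroSum (m : ℕ) : Submodule ℝ (EuclideanSpace ℝ (Fin (m + 1))) where
  carrier := {v | ∑ k, v k = 0}
  add_mem' {v w} hv hw := by
    simp only [Set.mem_ofPred_eq, PiLp.add_apply, sum_add_distrib] at *
    rw [hv, hw, add_zero]
  zero_mem' := by simp
  smul_mem' r v hv := by
    simp only [Set.mem_ofPred_eq, PiLp.smul_apply, smul_eq_mul, ← mul_sum] at *
    rw [hv, mul_zero]

/-- The hyperplane of vectors with zero coordinate sum, in coordinates. -/
noncomputable def zeroSumEquiv (m : ℕ) : (Fin m → ℝ) ≃ₗ[ℝ] zeroSum m where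
  toFun u := ⟨WithLp.toLp 2 (Fin.cons (-∑ i, u i) u), by
    change ∑ k, (Fin.cons (-∑ i, u i) u : Fin (m + 1) → ℝ) k = 0
    simp [Fin.sum_univ_succ]⟩
  map_add' u v := by
    ext k
    cases k using Fin.cases <;> simp [sum_add_distrib, add_comm]
  map_smul' r u := by
    ext k
    cases k using Fin.cases <;> simp [mul_sum]
  invFun v i := v.1 i.succ
  left_inv u := by
    ext i
    simp
  right_inv v := by
    have hv : ∑ k, v.1 k = 0 := v.2
    rw [Fin.sum_univ_succ] at hv
    ext k
    cases k using Fin.cases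
    · simp; linarith
    · simp

lemma continuous_simplexParam (m : ℕ) : Continuous (simplexParam m) := by
  refine (PiLp.continuous_toLp 2 _).comp (continuous_pi fun k ↦ ?_)
  cases k using Fin.cases <;> simp only [Fin.cons_zero, Fin.cons_succ] <;> fun_prop

/-- The standard simplex in Euclidean space. -/
def euclideanSimplex (n : ℕ) : Set (EuclideanSpace ℝ (Fin n)) :=
  {s | (∀ k, 0 ≤ s k) ∧ (∑ k, s k) = 1}

lemma measurableSet_euclideanSimplex (n : ℕ) : MeasurableSet (euclideanSimplex n) := by
  have h : IsClosed {s : EuclideanSpace ℝ (Fin n) | ∀ k, 0 ≤ s k} := by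
    simp only [Set.ofPred_forall]
    exact isClosed_iInter fun k ↦ isClosed_le (g := fun s : EuclideanSpace ℝ (Fin n) ↦ s k)
      continuous_const (by fun_prop)
  exact (h.inter (isClosed_eq (by fun_prop) continuous_const)).measurableSet

lemma simplexParam_preimage (m : ℕ) :
    simplexParam m ⁻¹' euclideanSimplex (m + 1) = cornerSimplex m := by
  ext u
  simp only [euclideanSimplex, cornerSimplex, simplexParam, Set.mem_preimage, Set.mem_ofPred_eq,
    Fin.forall_fin_succ, Fin.sum_univ_succ, Fin.cons_zero, Fin.cons_succ, sub_nonneg,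
    sub_add_cancel, and_true]
  exact and_comm

/-- Hausdorff measure on the simplex is proportional to Lebesgue measure in coordinates. -/
lemma hausdorffMeasure_restrict_euclideanSimplex (m : ℕ) :
    ∃ c : ENNReal, c ≠ 0 ∧ c ≠ ⊤ ∧
      (μH[(m : ℝ)] : Measure (EuclideanSpace ℝ (Fin (m + 1)))).restrict (euclideanSimplex (m + 1)) =
        c • (volume.restrict (cornerSimplex m)).map (simplexParam m) := by
  have hrank : Module.finrank ℝ (zeroSum m) = m := by
    rw [← (zeroSumEquiv m).finrank_eq]; simp
  have hH : (μH[(m : ℝ)] : Measure (zeroSum m)).IsAddHaarMeasure := by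
    have := isAddHaarMeasure_hausdorffMeasure (E := zeroSum m)
    rwa [hrank] at this
  obtain ⟨c, hc₀, hc, h⟩ : ∃ c : ENNReal, c ≠ 0 ∧ c ≠ ⊤ ∧ (μH[(m : ℝ)] : Measure (zeroSum m)) =
      c • (volume : Measure (Fin m → ℝ)).map (zeroSumEquiv m) :=
    ⟨_, by simpa using (Measure.addHaarScalarFactor_pos_of_isAddHaarMeasure _ _).ne',
      ENNReal.coe_ne_top, Measure.isAddLeftInvariant_eq_smul _ _⟩
  refine ⟨c, hc₀, hc, ?_⟩
  set ι : zeroSum m → EuclideanSpace ℝ (Fin (m + 1)) :=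
    fun v ↦ EuclideanSpace.single 0 (1 : ℝ) + (v : EuclideanSpace ℝ (Fin (m + 1))) with hι
  have hiso : Isometry ι := (isometry_add_left _).comp isometry_subtype_coe
  have hmap := hiso.map_hausdorffMeasure (d := m) (.inl m.cast_nonneg)
  have hcont : Continuous (zeroSumEquiv m) := (zeroSumEquiv m).toContinuousLinearEquiv.continuous
  have hcomp : ι ∘ zeroSumEquiv m = simplexParam m := by
    ext u k
    cases k using Fin.cases <;> simp [hι, zeroSumEquiv, simplexParam, sub_eq_add_neg]
  have hsub : euclideanSimplex (m + 1) ⊆ Set.range ι := fun s hs ↦ by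
    refine ⟨⟨s - EuclideanSpace.single 0 (1 : ℝ), ?_⟩, by simp [hι]⟩
    change ∑ k, (s - EuclideanSpace.single 0 (1 : ℝ) : EuclideanSpace ℝ (Fin (m + 1))) k = 0
    simp [hs.2]
  rw [h, Measure.map_smul, Measure.map_map hiso.continuous.measurable hcont.measurable,
    hcomp] at hmap
  have hres := congrArg (Measure.restrict · (euclideanSimplex (m + 1))) hmap
  simp only [Measure.restrict_restrict (measurableSet_euclideanSimplex _),
    Set.inter_eq_left.2 hsub, Measure.restrict_smul,
    Measure.restrict_map (continuous_simplexParam m).measurable (measurableSet_euclideanSimplex _),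
    simplexParam_preimage] at hres
  exact hres.symm

/-- The uniform distribution on the standard simplex, in coordinates. -/
lemma integral_uniform_euclideanSimplex (m : ℕ) {h : EuclideanSpace ℝ (Fin (m + 1)) → ℝ}
    (hh : Continuous h) :
    ∫ s, h s ∂((μH[(m : ℝ)] (euclideanSimplex (m + 1)))⁻¹ •
        (μH[(m : ℝ)]).restrict (euclideanSimplex (m + 1))) =
      (volume.real (cornerSimplex m))⁻¹ * ∫ u in cornerSimplex m, h (simplexParam m u) := by
  obtain ⟨c, hc₀, hc, hres⟩ := hausdorffMeasure_restrict_euclideanSimplex m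
  have hmeas := (continuous_simplexParam m).measurable
  have hmass : μH[(m : ℝ)] (euclideanSimplex (m + 1)) = c * volume (cornerSimplex m) := by
    rw [← Measure.restrict_apply_univ, hres, Measure.smul_apply,
      Measure.map_apply hmeas .univ, Set.preimage_univ, Measure.restrict_apply_univ, smul_eq_mul]
  rw [hmass, hres, integral_smul_measure, integral_smul_measure,
    integral_map hmeas.aemeasurable hh.aestronglyMeasurable, smul_smul, smul_eq_mul,
    ENNReal.toReal_inv, ENNReal.toReal_mul, measureReal_def]
  have : c.toReal ≠ 0 := ENNReal.toReal_ne_zero.2 ⟨hc₀, hc⟩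
  congr 1
  field_simp

lemma mul_dividedDiff {n : ℕ} (r : ℝ) (x : Fin n → ℝ) (f : ℝ → ℝ) :
    r * dividedDiff x f = dividedDiff x (fun s ↦ r * f s) := by
  simp only [dividedDiff, mul_sum, mul_div_assoc]

lemma hermite_genocchi_truncatedPower {p : ℕ} {x : Fin (p + 2) → ℝ} (hx : x.Injective) (c : ℝ)
    {g : ℝ → ℝ} (hg : Continuous g) :
    (p.factorial : ℝ) * ∫ u in cornerSimplex (p + 1), g (∑ k, x k * simplexParam (p + 1) u k) =
      dividedDiff x (fun s ↦ ∫ t in c..s, (s - t) ^ p * g t) := by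
  have hHG := hermite_genocchi c (a := x 0) (y := Fin.tail x)
    (hx.comp (Fin.succ_injective _)) (fun i h ↦ Fin.succ_ne_zero i (hx h)) hg
  rw [Fin.cons_self_tail] at hHG
  have harg : ∀ u : Fin (p + 1) → ℝ, ∑ k, x k * simplexParam (p + 1) u k =
      x 0 + ∑ i, u i * (Fin.tail x i - x 0) := fun u ↦ by
    rw [Fin.sum_univ_succ]
    simp only [simplexParam, Fin.cons_zero, Fin.cons_succ, Fin.tail, mul_sub, sum_sub_distrib,
      ← sum_mul, mul_comm (x _)]
    ring
  simp only [harg, hHG, mul_dividedDiff, iterate_primitiveFrom c p hg]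

lemma volume_cornerSimplex_mul_factorial (p : ℕ) :
    ((p + 1).factorial : ℝ) * volume.real (cornerSimplex (p + 1)) = 1 := by
  have hx : (fun k : Fin (p + 2) ↦ (k : ℝ)).Injective := fun i j h ↦ Fin.ext (Nat.cast_injective h)
  have h := hermite_genocchi_truncatedPower hx 0 (g := fun _ ↦ 1) continuous_const
  simp only [integral_const, smul_eq_mul, mul_one, measureReal_restrict_apply_univ,
    intervalIntegral.integral_comp_sub_left (fun t ↦ t ^ p), integral_pow] at h
  rw [Nat.factorial_succ, Nat.cast_mul, mul_assoc, h, mul_dividedDiff]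
  refine Eq.trans ?_ (dividedDiff_pow_self hx 0)
  congr 1
  ext s
  have : (p + 1 : ℝ) ≠ 0 := by positivity
  push_cast
  simp
  field_simp

lemma integrableOn_Ioi_truncatedPower {p : ℕ} (hp : p ≠ 0) (c s : ℝ) {g : ℝ → ℝ}
    (hg : Continuous g) : IntegrableOn (fun t ↦ (max (s - t) 0) ^ p * g t) (Set.Ioi c) := by
  have h : IntegrableOn (fun t ↦ (max (s - t) 0) ^ p * g t) (Set.Ioc c s) :=
    (by fun_prop : Continuous fun t ↦ (max (s - t) 0) ^ p * g t).integrableOn_Ioc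
  refine h.of_forall_sdiff_eq_zero measurableSet_Ioi fun t ht ↦ ?_
  have hst : s < t := by simpa [ht.1.out] using ht.2
  rw [max_eq_right (by linarith), zero_pow hp, zero_mul]

lemma setIntegral_Ioi_truncatedPower {p : ℕ} (hp : p ≠ 0) {c s : ℝ} (hcs : c ≤ s) (g : ℝ → ℝ) :
    ∫ t in Set.Ioi c, (max (s - t) 0) ^ p * g t = ∫ t in c..s, (s - t) ^ p * g t := by
  rw [intervalIntegral.integral_of_le hcs, setIntegral_eq_of_subset_of_forall_sdiff_eq_zero
    measurableSet_Ioi (Set.Ioc_subset_Ioi_self : Set.Ioc c s ⊆ _)]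
  · refine setIntegral_congr_fun measurableSet_Ioc fun t ht ↦ ?_
    simp only [max_eq_left (sub_nonneg.2 ht.2)]
  · intro t ht
    have hst : s < t := by simpa [ht.1.out] using ht.2
    rw [max_eq_right (by linarith), zero_pow hp, zero_mul]

lemma integral_bspline_mul {p : ℕ} (hp : p ≠ 0) {x : Fin (p + 2) → ℝ} (hx : StrictMono x)
    {g : ℝ → ℝ} (hg : Continuous g) :
    ∫ t, dividedDiff x (fun s ↦ (max (s - t) 0) ^ p) * g t =
      dividedDiff x (fun s ↦ ∫ t in (x 0)..s, (s - t) ^ p * g t) := by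
  have hx0 : ∀ k, x 0 ≤ x k := fun k ↦ hx.monotone (Fin.zero_le k)
  rw [← setIntegral_eq_integral_of_forall_compl_eq_zero (s := Set.Ioi (x 0))]
  · simp only [dividedDiff, sum_mul, div_mul_eq_mul_div]
    rw [integral_finsetSum _ fun k _ ↦
      (integrableOn_Ioi_truncatedPower hp (x 0) (x k) hg).div_const _]
    simp only [integral_div, setIntegral_Ioi_truncatedPower hp (hx0 _)]
  · intro t ht
    have h : dividedDiff x (fun s ↦ (max (s - t) 0) ^ p) = dividedDiff x (fun s ↦ (s - t) ^ p) :=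
      sum_congr rfl fun k _ ↦ by
        simp only [max_eq_left (sub_nonneg.2 ((not_lt.1 ht).trans (hx0 k)))]
    rw [h, dividedDiff_pow_of_lt hx.injective (by lia), zero_mul]

/-- `(n-1)·B` is the probability density of `⟨x, S⟩` where `S` is uniform on the standard
simplex: for every bounded continuous `g`, `(n-1)∫ B g = E[g(⟨x,S⟩)]`. -/
theorem bspline_density_simplex (n : ℕ) (hn : 3 ≤ n) (x : Fin n → ℝ) (hx : StrictMono x)
    (g : ℝ → ℝ) (hg : Continuous g) (hgb : ∃ M : ℝ, ∀ t, |g t| ≤ M) :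
    (let B : ℝ → ℝ := fun t =>
      ∑ k, (max (x k - t) 0) ^ (n - 2) / ∏ j ∈ univ.erase k, (x k - x j);
    let Δ : Set (EuclideanSpace ℝ (Fin n)) :=
      {s | (∀ k, 0 ≤ s k) ∧ (∑ k, s k) = 1};
    let μ : Measure (EuclideanSpace ℝ (Fin n)) :=
      (μH[(n : ℝ) - 1] Δ)⁻¹ • (μH[(n : ℝ) - 1]).restrict Δ;
    ((n : ℝ) - 1) * ∫ t : ℝ, B t * g t = ∫ s, g (∑ k, x k * s k) ∂μ) := by
  obtain ⟨p, rfl⟩ : ∃ p, n = p + 2 := ⟨n - 2, by lia⟩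
  have hp : p ≠ 0 := by lia
  have hcast : ((p + 2 : ℕ) : ℝ) - 1 = ((p + 1 : ℕ) : ℝ) := by push_cast; ring
  intro B Δ μ
  have hμ := integral_uniform_euclideanSimplex (p + 1)
    (h := fun s ↦ g (∑ k, x k * s k)) (by fun_prop)
  have hB : ∫ t, B t * g t = _ := integral_bspline_mul hp hx hg
  have hvol := eq_inv_of_mul_eq_one_right (volume_cornerSimplex_mul_factorial p)
  simp only [μ, hcast]
  refine Eq.trans ?_ hμ.symm
  rw [hB, ← hermite_genocchi_truncatedPower hx.injective _ hg, hvol, inv_inv,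
    Nat.factorial_succ, Nat.cast_mul, mul_assoc]
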